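/- (Tychonoff-type fixed point theorem, Theorem 2.1.) Let C be a nonempty, bounded, closed and convex subset of a real reflexive Banach space E, and let S: C → 2^C be a multivalued map such that (i) S has nonempty, bounded, closed and convex values, and (ii) S is weakly-weakly upper semicontinuous, i.e. upper semicontinuous as a map from C with the relative weak topology of E into subsets of C with the weak topology. Then S has a fixed point in C, i.e. there exists x ∈ C with x ∈ S(x). -/

import Mathlib

open Filter Topology Set

noncomputable section

/-- Clarke generalized directional derivative of `f` at `u` in direction `v`:
`f⁰(u;v) = limsup_{w → u, λ → 0⁺} (f(w + λ v) - f(w))/λ`. -/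
def clarkeDeriv {X : Type*} [NormedAddCommGroup X] [NormedSpace ℝ X]
    (f : X → ℝ) (u v : X) : ℝ :=
  Filter.limsup (fun p : X × ℝ => (f (p.1 + p.2 • v) - f p.1) / p.2)
    ((𝓝 u) ×ˢ (𝓝[>] (0 : ℝ)))

/-- Clarke generalized subgradient of `f` at `u`. -/
def clarkeSubgrad {X : Type*} [NormedAddCommGroup X] [NormedSpace ℝ X]
    (f : X → ℝ) (u : X) : Set (X →L[ℝ] ℝ) :=
  {ξ | ∀ v : X, ξ v ≤ clarkeDeriv f u v}

/-- Weak convergence of a sequence in a normed space. -/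
def WeakConv {V : Type*} [NormedAddCommGroup V] [NormedSpace ℝ V]
    (u : ℕ → V) (u₀ : V) : Prop :=
  ∀ f : V →L[ℝ] ℝ, Filter.Tendsto (fun n => f (u n)) atTop (𝓝 (f u₀))

/-- `ψ`-pseudomonotonicity of a multivalued operator `T : V → 2^{V*}`:
if some `u* ∈ T u` satisfies `⟨u*, v-u⟩ + ψ v - ψ u ≥ 0`, then
`⟨v*, v-u⟩ + ψ v - ψ u ≥ 0` for all `v* ∈ T v` (written without `EReal` subtraction). -/
def PseudoMonotone {V : Type*} [NormedAddCommGroup V] [NormedSpace ℝ V]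
    (ψ : V → EReal) (T : V → Set (V →L[ℝ] ℝ)) : Prop :=
  ∀ u v : V,
    (∃ us ∈ T u, ψ u ≤ ((us (v - u) : ℝ) : EReal) + ψ v) →
    ∀ vs ∈ T v, ψ u ≤ ((vs (v - u) : ℝ) : EReal) + ψ v

/-- Stable `ψ`-pseudomonotonicity with respect to `{h}`. -/
def StablePseudoMonotone {V : Type*} [NormedAddCommGroup V] [NormedSpace ℝ V]
    (ψ : V → EReal) (T : V → Set (V →L[ℝ] ℝ)) (h : V →L[ℝ] ℝ) : Prop :=
  PseudoMonotone ψ T ∧ PseudoMonotone ψ (fun u => (fun t => t - h) '' T u)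

/-- The three growth ("bullet") conditions on a coercivity function `r`. -/
def CoerciveBullets (r : ℝ → ℝ → ℝ) : Prop :=
  (∀ s : ℝ, 0 ≤ s → Filter.Tendsto (fun t => r t s) atTop atTop) ∧
  (∀ c₁ c₂ : ℝ, 0 ≤ c₁ → 0 ≤ c₂ →
    Filter.Tendsto (fun t => r t (c₁ * t + c₂)) atTop atTop) ∧
  (∀ s t : ℕ → ℝ, Filter.Tendsto s atTop atTop → Filter.Tendsto t atTop atTop →
    Filter.Tendsto (fun n => t n / s n) atTop (𝓝 0) →
    Filter.Tendsto (fun n => r (s n) (t n)) atTop atTop)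

/-- Upper semicontinuity of a multivalued map. -/
def UpperSemicontinuousMV {α β : Type*} [TopologicalSpace α] [TopologicalSpace β]
    (F : α → Set β) : Prop :=
  ∀ x : α, ∀ O : Set β, IsOpen O → F x ⊆ O → ∃ N ∈ 𝓝 x, ∀ y ∈ N, F y ⊆ O

section Scarf

variable {I T : Type*}

/-- A finite set `P` is dominant for the rankings `r i` if no element of `T` ranks strictly above
the minimum of `P` in all rankings simultaneously. -/
def Dominant (r : I → T → ℕ) (P : Finset T) : Prop :=
  ∀ y, ∃ i, ∀ x ∈ P, r i y ≤ r i x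

theorem Dominant.mono {r : I → T → ℕ} {P Q : Finset T} (hP : Dominant r P) (h : Q ⊆ P) :
    Dominant r Q := fun y => (hP y).imp fun _ hi x hx => hi x (h hx)

open Classical in
/-- A dominant set with one element less than the number of rankings, which can be exceeded
strictly in any family of all but one rankings, has exactly two one-point dominant extensions. -/
theorem Dominant.card_completions_eq_two [Fintype I] [Fintype T] {r : I → T → ℕ} (hr : ∀ i, Function.Injective (r i))
    {Q : Finset T} (hQ : Dominant r Q) (hne : Q.Nonempty) (hcard : Q.card + 1 = Fintype.card I)
    (hup : ∀ a, ∃ y, ∀ k, k ≠ a → ∃ x ∈ Q, r k x < r k y) :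
    (Finset.univ.filter fun x => x ∉ Q ∧ Dominant r (insert x Q)).card = 2 := by
  choose m hmQ hmin using fun i => Q.exists_min_image (r i) hne
  have hsurj : ∀ q ∈ Q, ∀ i, (∀ x ∈ Q, r i q ≤ r i x) → m i = q := fun q hq i hi =>
    hr i (le_antisymm (hmin i q hq) (hi _ (hmQ i)))
  obtain ⟨a, -, b, -, hab, hmab⟩ := Finset.exists_ne_map_eq_of_card_lt_of_maps_to
    (s := (Finset.univ : Finset I)) (t := Q) (by rw [Finset.card_univ]; omega)
    (f := m) (fun i _ => hmQ i)
  have inj : ∀ c d, c ≠ d → m c = m d → ∀ i j, i ≠ c → j ≠ c → m i = m j → i = j := by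
    intro c d hcd hm
    have himg : (Finset.univ.erase c).image m = Q := by
      ext q
      simp only [Finset.mem_image, Finset.mem_erase, Finset.mem_univ, and_true]
      constructor
      · rintro ⟨i, -, rfl⟩
        exact hmQ i
      · intro hq
        obtain ⟨i, hi⟩ := hQ q
        have hi := hsurj q hq i hi
        by_cases hic : i = c
        · exact ⟨d, hcd.symm, by rw [← hm, ← hic, hi]⟩
        · exact ⟨i, hic, hi⟩
    have hinj : Set.InjOn m (Finset.univ.erase c : Finset I) := by
      apply Finset.injOn_of_card_image_eq
      rw [himg, Finset.card_erase_of_mem (Finset.mem_univ _), Finset.card_univ]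
      omega
    intro i j hi hj hij
    exact hinj (by simpa using hi) (by simpa using hj) hij
  have inja := inj a b hab hmab
  have injb := inj b a hab.symm hmab.symm
  have hmax : ∀ c, ∃ x, (∀ k, k ≠ c → r k (m k) < r k x) ∧
      ∀ y, (∀ k, k ≠ c → r k (m k) < r k y) → r c y ≤ r c x := by
    intro c
    obtain ⟨y, hy⟩ := hup c
    obtain ⟨x, hx, hx'⟩ := (Finset.univ.filter fun x =>
      ∀ k, k ≠ c → r k (m k) < r k x).exists_max_image (r c) ⟨y, by
        simp only [Finset.mem_filter, Finset.mem_univ, true_and]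
        intro k hk
        obtain ⟨x, hx, hxy⟩ := hy k hk
        exact (hmin k x hx).trans_lt hxy⟩
    simp only [Finset.mem_filter, Finset.mem_univ, true_and] at hx hx'
    exact ⟨x, hx, hx'⟩
  choose e he hemax using hmax
  have hgood : ∀ c d, c ≠ d → m c = m d → e c ∉ Q ∧ Dominant r (insert (e c) Q) := by
    intro c d hcd hm
    constructor
    · intro hmem
      obtain ⟨i, hi⟩ := hQ (e c)
      have hi := hsurj _ hmem i hi
      by_cases hic : i = c
      · have hi' : m c = e c := hic ▸ hi
        have := he c d hcd.symm
        rw [← hm, hi'] at this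
        exact this.false
      · have := he c i hic
        rw [hi] at this
        exact this.false
    · intro y
      by_cases hy : ∀ k, k ≠ c → r k (m k) < r k y
      · obtain ⟨i, hi⟩ := hQ y
        have hic : i = c := by
          by_contra hic
          exact (hy i hic).not_ge (hi _ (hmQ i))
        subst hic
        refine ⟨i, fun x hx => ?_⟩
        rcases Finset.mem_insert.1 hx with rfl | hx
        · exact hemax i y hy
        · exact hi x hx
      · push Not at hy
        obtain ⟨k, hk, hky⟩ := hy
        refine ⟨k, fun x hx => ?_⟩
        rcases Finset.mem_insert.1 hx with rfl | hx
        · exact hky.trans (he c k hk).le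
        · exact hky.trans (hmin k x hx)
  have huniq : ∀ x ∉ Q, Dominant r (insert x Q) → x = e a ∨ x = e b := by
    intro x hx hdom
    have hz : ∀ z ∈ Q, ∃ i, m i = z ∧ r i (m i) < r i x := by
      intro z hz
      obtain ⟨i, hi⟩ := hdom z
      have h1 := hsurj z hz i fun w hw => hi w (Finset.mem_insert_of_mem hw)
      refine ⟨i, h1, lt_of_le_of_ne (h1 ▸ hi x (Finset.mem_insert_self _ _)) fun h => ?_⟩
      exact hx (hr i h ▸ hmQ i)
    have hother : ∀ k, k ≠ a → k ≠ b → r k (m k) < r k x := by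
      intro k hka hkb
      obtain ⟨i, hi, hix⟩ := hz _ (hmQ k)
      have : i = k := by
        by_cases hia : i = a
        · exact injb i k (hia ▸ hab) hkb hi
        · exact inja i k hia hka hi
      exact this ▸ hix
    have hfin : ∀ c, (∀ k, k ≠ c → r k (m k) < r k x) → x = e c := by
      intro c hc
      refine hr c (le_antisymm (hemax c x hc) ?_)
      obtain ⟨i, hi⟩ := hdom (e c)
      have hic : i = c := by
        by_contra hic
        exact (he c i hic).not_ge (hi _ (Finset.mem_insert_of_mem (hmQ i)))
      exact hic ▸ hi x (Finset.mem_insert_self _ _)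
    obtain ⟨i, hi, hix⟩ := hz _ (hmQ a)
    by_cases hia : i = a
    · right
      refine hfin b fun k hk => ?_
      by_cases hka : k = a
      · rw [hka, ← hia]; exact hix
      · exact hother k hka hk
    · left
      have hib : i = b := inja i b hia hab.symm (hi.trans hmab)
      refine hfin a fun k hk => ?_
      by_cases hkb : k = b
      · rw [hkb, ← hib]; exact hix
      · exact hother k hk hkb
  have hne' : e a ≠ e b := by
    intro h
    obtain ⟨i, hi⟩ := hQ (e a)
    have := hi _ (hmQ i)
    by_cases hia : i = a
    · exact (he b i (hia ▸ hab)).not_ge (h ▸ this)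
    · exact (he a i hia).not_ge this
  rw [Finset.card_eq_two]
  refine ⟨e a, e b, hne', ?_⟩
  ext x
  simp only [Finset.mem_filter, Finset.mem_univ, true_and, Finset.mem_insert, Finset.mem_singleton]
  constructor
  · rintro ⟨h1, h2⟩
    exact huniq x h1 h2
  · rintro (rfl | rfl)
    · exact hgood a b hab hmab
    · exact hgood b a hab.symm hmab.symm

/-- In a set with as many elements as there are colours, not all colours being present, the number
of one-point deletions carrying exactly the colours other than `i₀` is even. -/
theorem even_card_erase_colored [Fintype I] [DecidableEq I] [DecidableEq T] (c : T → I) (i₀ : I) {P : Finset T}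
    (hP : P.card = Fintype.card I) (hc : P.image c ≠ Finset.univ) :
    Even (P.powerset.filter fun Q => Q.card + 1 = Fintype.card I ∧
      Q.image c = Finset.univ.erase i₀).card := by
  rcases Finset.eq_empty_or_nonempty (P.powerset.filter fun Q => Q.card + 1 = Fintype.card I ∧
      Q.image c = Finset.univ.erase i₀) with h | ⟨Q, hQ⟩
  · simp [h]
  simp only [Finset.mem_filter, Finset.mem_powerset] at hQ
  obtain ⟨hQP, hQcard, hQc⟩ := hQ
  obtain ⟨x, hxQ, rfl⟩ := Finset.exists_eq_insert_iff.2 ⟨hQP, hQcard.trans hP.symm⟩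
  have hcx : c x ≠ i₀ := by
    rintro rfl
    apply hc
    rw [Finset.image_insert, hQc, Finset.insert_erase (Finset.mem_univ _)]
  have hinj : Set.InjOn c Q := by
    apply Finset.injOn_of_card_image_eq
    rw [hQc, Finset.card_erase_of_mem (Finset.mem_univ _), Finset.card_univ]
    omega
  obtain ⟨w, hwQ, hwx⟩ : ∃ w ∈ Q, c w = c x := by
    have : c x ∈ Q.image c := by rw [hQc]; simpa using hcx
    simpa using this
  have hxw : x ≠ w := fun h => hxQ (h ▸ hwQ)
  have h2 : (insert x Q).erase w ≠ Q := fun h => by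
    have := h ▸ hwQ
    simp at this
  have hwimg : ((insert x Q).erase w).image c = Finset.univ.erase i₀ := by
    rw [← hQc]
    ext i
    simp only [Finset.mem_image, Finset.mem_erase, Finset.mem_insert]
    constructor
    · rintro ⟨z, ⟨-, rfl | hz⟩, rfl⟩
      · exact ⟨w, hwQ, hwx⟩
      · exact ⟨z, hz, rfl⟩
    · rintro ⟨z, hz, rfl⟩
      by_cases hzw : z = w
      · exact ⟨x, ⟨hxw, Or.inl rfl⟩, by rw [hzw, hwx]⟩
      · exact ⟨z, ⟨hzw, Or.inr hz⟩, rfl⟩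
  have hcard2 : (insert x Q).card = Q.card + 1 := Finset.card_insert_of_notMem hxQ
  suffices h : (insert x Q).powerset.filter (fun R => R.card + 1 = Fintype.card I ∧
      R.image c = Finset.univ.erase i₀) = {Q, (insert x Q).erase w} by
    rw [h, Finset.card_pair h2.symm]
    exact even_two
  ext R
  simp only [Finset.mem_filter, Finset.mem_powerset, Finset.mem_insert, Finset.mem_singleton]
  constructor
  · rintro ⟨hRP, hRcard, hRc⟩
    obtain ⟨z, hzR, hz⟩ := Finset.exists_eq_insert_iff.2 ⟨hRP, hRcard.trans hP.symm⟩
    have hRz : R = (insert x Q).erase z := by rw [← hz, Finset.erase_insert hzR]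
    by_cases hzx : z = x
    · left; rw [hRz, hzx, Finset.erase_insert hxQ]
    right
    have hzQ : z ∈ Q := by
      have : z ∈ insert x Q := by rw [← hz]; exact Finset.mem_insert_self _ _
      exact (Finset.mem_insert.1 this).resolve_left hzx
    obtain ⟨v, hvR, hvz⟩ : ∃ v ∈ R, c v = c z := by
      have : c z ∈ R.image c := by rw [hRc, ← hQc]; exact Finset.mem_image_of_mem c hzQ
      simpa using this
    have hvz' : v ≠ z := fun h => hzR (h ▸ hvR)
    have hvx : v = x := by
      rcases Finset.mem_insert.1 (hRP hvR) with h | h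
      · exact h
      · exact absurd (hinj h hzQ hvz) hvz'
    rw [hRz, hinj hzQ hwQ (by rw [hwx, ← hvz, hvx])]
  · rintro (rfl | rfl)
    · exact ⟨hQP, hQcard, hQc⟩
    · refine ⟨Finset.erase_subset _ _, ?_, hwimg⟩
      rw [Finset.card_erase_of_mem (Finset.mem_insert_of_mem hwQ)]
      omega

open Classical in
theorem card_filter_superset_eq [Fintype I] [Fintype T] {r : I → T → ℕ} {Q : Finset T}
    (hcard : Q.card + 1 = Fintype.card I) :
    (Finset.univ.filter fun P => (Dominant r P ∧ P.card = Fintype.card I) ∧ Q ⊆ P).card =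
      (Finset.univ.filter fun x => x ∉ Q ∧ Dominant r (insert x Q)).card := by
  symm
  refine Finset.card_bij (fun x _ => insert x Q) ?_ ?_ ?_
  · intro x hx
    simp only [Finset.mem_filter, Finset.mem_univ, true_and] at hx ⊢
    exact ⟨⟨hx.2, by rw [Finset.card_insert_of_notMem hx.1, hcard]⟩, Finset.subset_insert _ _⟩
  · intro x hx y hy hxy
    simp only [Finset.mem_filter, Finset.mem_univ, true_and] at hx hy
    have : x ∈ insert y Q := hxy ▸ Finset.mem_insert_self _ _
    exact (Finset.mem_insert.1 this).resolve_right hx.1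
  · intro P hP
    simp only [Finset.mem_filter, Finset.mem_univ, true_and] at hP
    obtain ⟨x, hx, rfl⟩ := Finset.exists_eq_insert_iff.2 ⟨hP.2, hcard.trans hP.1.2.symm⟩
    exact ⟨x, by simpa using ⟨hx, hP.1.1⟩, rfl⟩

/-- Scarf's theorem in the presence of slack elements `s i`. -/
theorem exists_dominant_colored_of_slack [Fintype I] [Fintype T] [DecidableEq I] [Nonempty I]
    {r : I → T → ℕ}
    (hr : ∀ i, Function.Injective (r i)) {c : T → I} {s : I → T} (hc : ∀ i, c (s i) = i)
    (hmin : ∀ i y, r i (s i) ≤ r i y)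
    (htop : ∀ t ∉ Set.range s, ∀ i k, k ≠ i → r k t < r k (s i))
    {t₀ : T} (ht₀ : t₀ ∉ Set.range s) :
    ∃ P : Finset T, Dominant r P ∧ P.image c = Finset.univ := by
  classical
  by_contra! hcon
  let i₀ : I := Classical.arbitrary I
  have hs : Function.Injective s := fun i j h => by rw [← hc i, h, hc]
  have hlow : ∀ i y, r i y ≤ r i (s i) → y = s i := fun i y h =>
    hr i (le_antisymm h (hmin i y))
  set Q₀ : Finset T := (Finset.univ.erase i₀).image s with hQ₀
  have hQ₀card : Q₀.card + 1 = Fintype.card I := by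
    rw [hQ₀, Finset.card_image_of_injective _ hs, Finset.card_erase_of_mem (Finset.mem_univ _),
      Finset.card_univ]
    have := Fintype.card_pos (α := I)
    omega
  have hQ₀dom : ∀ x, x ∉ Set.range s → (∀ y, y ∉ Set.range s → r i₀ y ≤ r i₀ x) →
      Dominant r (insert x Q₀) := by
    intro x hx hxmax y
    by_cases hy : y ∈ Set.range s
    · obtain ⟨k, rfl⟩ := hy
      exact ⟨k, fun z _ => hmin k z⟩
    · refine ⟨i₀, fun z hz => ?_⟩
      rcases Finset.mem_insert.1 hz with rfl | hz
      · exact hxmax y hy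
      · simp only [hQ₀, Finset.mem_image, Finset.mem_erase, Finset.mem_univ, and_true] at hz
        obtain ⟨k, hk, rfl⟩ := hz
        exact (htop y hy k i₀ hk.symm).le
  obtain ⟨x₀, hx₀, hx₀max⟩ := (Finset.univ.filter fun t => t ∉ Set.range s).exists_max_image (r i₀)
    ⟨t₀, by simpa using ht₀⟩
  replace hx₀ : x₀ ∉ Set.range s := by simpa using hx₀
  replace hx₀max : ∀ y, y ∉ Set.range s → r i₀ y ≤ r i₀ x₀ := fun y hy =>
    hx₀max y (by simpa using hy)
  have hQ₀count : (Finset.univ.filter fun x => x ∉ Q₀ ∧ Dominant r (insert x Q₀)).card = 1 := by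
    rw [Finset.card_eq_one]
    refine ⟨x₀, ?_⟩
    ext x
    simp only [Finset.mem_filter, Finset.mem_univ, true_and, Finset.mem_singleton]
    constructor
    · rintro ⟨hxQ, hdom⟩
      have hkey : ∀ y, y ∉ Set.range s → r i₀ y ≤ r i₀ x := by
        intro y hy
        obtain ⟨i, hi⟩ := hdom y
        by_cases hii : i = i₀
        · exact hii ▸ hi x (Finset.mem_insert_self _ _)
        · refine absurd ⟨i, (hlow i y (hi (s i) ?_)).symm⟩ hy
          exact Finset.mem_insert_of_mem (Finset.mem_image_of_mem s (by simpa using hii))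
      have hxs : x ∉ Set.range s := by
        rintro ⟨k, rfl⟩
        have hk : k = i₀ := by
          by_contra hk
          exact hxQ (Finset.mem_image_of_mem s (by simpa using hk))
        exact ht₀ ⟨i₀, (hlow i₀ t₀ (by simpa [hk] using hkey t₀ ht₀)).symm⟩
      exact hr i₀ (le_antisymm (hx₀max x hxs) (hkey x₀ hx₀))
    · rintro rfl
      refine ⟨fun h => hx₀ ?_, hQ₀dom x hx₀ hx₀max⟩
      simp only [hQ₀, Finset.mem_image] at h
      obtain ⟨k, -, hk⟩ := h
      exact ⟨k, hk⟩
  let D : Finset (Finset T) := Finset.univ.filter fun Q =>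
    Dominant r Q ∧ Q.card + 1 = Fintype.card I ∧ Q.image c = Finset.univ.erase i₀
  let R : Finset (Finset T) := Finset.univ.filter fun P => Dominant r P ∧ P.card = Fintype.card I
  have hdc := Finset.sum_card_bipartiteAbove_eq_sum_card_bipartiteBelow (s := D) (t := R)
    (fun Q P => Q ⊆ P)
  have hright : Even (∑ P ∈ R, (D.bipartiteBelow (fun Q P => Q ⊆ P) P).card) := by
    refine Finset.even_sum _ fun P hP => ?_
    simp only [R, Finset.mem_filter, Finset.mem_univ, true_and] at hP
    have := even_card_erase_colored c i₀ hP.2 (hcon P hP.1)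
    refine (congrArg Even (congrArg Finset.card ?_)).mpr this
    ext Q
    simp only [Finset.bipartiteBelow, D, Finset.mem_filter, Finset.mem_univ, true_and,
      Finset.mem_powerset]
    exact ⟨fun h => ⟨h.2, h.1.2⟩, fun h => ⟨⟨hP.1.mono h.1, h.2⟩, h.1⟩⟩
  have hcount : ∀ Q ∈ D, (R.bipartiteAbove (fun Q P => Q ⊆ P) Q).card =
      (Finset.univ.filter fun x => x ∉ Q ∧ Dominant r (insert x Q)).card := by
    intro Q hQ
    simp only [D, Finset.mem_filter, Finset.mem_univ, true_and] at hQ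
    rw [← card_filter_superset_eq hQ.2.1]
    simp only [Finset.bipartiteAbove, R, Finset.filter_filter]
  have hQ₀D : Q₀ ∈ D := by
    simp only [D, Finset.mem_filter, Finset.mem_univ, true_and]
    refine ⟨(hQ₀dom x₀ hx₀ hx₀max).mono (Finset.subset_insert _ _), hQ₀card, ?_⟩
    rw [hQ₀, Finset.image_image]
    simp [Function.comp_def, hc]
  have hleft : Even (∑ Q ∈ D.erase Q₀, (R.bipartiteAbove (fun Q P => Q ⊆ P) Q).card) := by
    refine Finset.even_sum _ fun Q hQ => ?_
    obtain ⟨hne, hQD⟩ := Finset.mem_erase.1 hQ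
    rw [hcount Q hQD]
    simp only [D, Finset.mem_filter, Finset.mem_univ, true_and] at hQD
    obtain ⟨t, htQ, ht⟩ : ∃ t ∈ Q, t ∉ Set.range s := by
      by_contra! h
      refine hne (Finset.eq_of_subset_of_card_le (fun x hx => ?_) (by omega))
      obtain ⟨k, rfl⟩ := h x hx
      have : c (s k) ∈ Q.image c := Finset.mem_image_of_mem c hx
      rw [hQD.2.2, hc] at this
      exact Finset.mem_image_of_mem s this
    rw [hQD.1.card_completions_eq_two hr ⟨t, htQ⟩ hQD.2.1
      fun a => ⟨s a, fun k hk => ⟨t, htQ, htop t ht a k hk⟩⟩]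
    exact even_two
  rw [← Finset.add_sum_erase D _ hQ₀D, hcount Q₀ hQ₀D, hQ₀count] at hdc
  rw [← hdc] at hright
  rw [add_comm, Nat.even_add_one] at hright
  exact hright hleft

end Scarf

/-- **Scarf's theorem**: for any colouring of a finite set carrying one ranking per colour there is
a nonempty set `σ` no element of which can be beaten simultaneously in all the rankings whose
colours occur in `σ`. -/
theorem exists_dominant_colored {I T : Type*} [Fintype I] [Fintype T] [Nonempty I] [Nonempty T]
    {r : I → T → ℕ} (hr : ∀ i, Function.Injective (r i)) (c : T → I) :
    ∃ σ : Finset T, σ.Nonempty ∧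
      ∀ y, ∃ z ∈ σ, ∀ x ∈ σ, r (c z) y ≤ r (c z) x := by
  classical
  obtain ⟨B, hB⟩ : ∃ B, ∀ i t, r i t ≤ B :=
    ⟨Finset.univ.sup fun p : I × T => r p.1 p.2, fun i t =>
      Finset.le_sup (f := fun p : I × T => r p.1 p.2) (Finset.mem_univ (i, t))⟩
  let e := Fintype.equivFin I
  let r' : I → T ⊕ I → ℕ := fun i =>
    Sum.elim (fun t => r i t + 1) (fun k => if k = i then 0 else B + e k + 2)
  obtain ⟨P, hP, hPc⟩ := exists_dominant_colored_of_slack (r := r') (c := Sum.elim c id)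
    (s := Sum.inr) (t₀ := Sum.inl (Classical.arbitrary T))
    (by
      rintro i (t | k) (t' | k') h
      · simp only [r', Sum.elim_inl, Nat.add_right_cancel_iff] at h
        rw [hr i h]
      · simp only [r', Sum.elim_inl, Sum.elim_inr] at h
        have := hB i t
        split_ifs at h
        omega
      · simp only [r', Sum.elim_inl, Sum.elim_inr] at h
        have := hB i t'
        split_ifs at h
        omega
      · simp only [r', Sum.elim_inr] at h
        split_ifs at h with h1 h2 h2
        · rw [h1, h2]
        · have : e k = e k' := Fin.ext (by omega)
          rw [e.injective this])
    (fun i => rfl)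
    (by
      intro i y
      simp [r'])
    (by
      rintro (t | k) ht i k' hk
      · have := hB k' t
        simp only [r', Sum.elim_inl, Sum.elim_inr, if_neg hk.symm]
        omega
      · exact absurd ⟨k, rfl⟩ ht)
    (by simp)
  have hdom : ∀ y : T, ∃ z, Sum.inl z ∈ P ∧ ∀ x, Sum.inl x ∈ P → r (c z) y ≤ r (c z) x := by
    intro y
    obtain ⟨i, hi⟩ := hP (Sum.inl y)
    have hiP : Sum.inr i ∉ P := fun h => by simpa [r'] using hi _ h
    have himg : i ∈ P.image (Sum.elim c id) := by rw [hPc]; exact Finset.mem_univ _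
    obtain ⟨z | k, hz, rfl⟩ := Finset.mem_image.1 himg
    · exact ⟨z, hz, fun x hx => by simpa [r'] using hi _ hx⟩
    · exact absurd hz hiP
  refine ⟨Finset.univ.filter fun t => Sum.inl t ∈ P, ?_, by simpa using hdom⟩
  obtain ⟨z, hz, -⟩ := hdom (Classical.arbitrary T)
  exact ⟨z, by simpa using hz⟩

/-- A Sperner-type lemma for the lattice points of a dilated simplex. -/
theorem exists_small_colored_grid {I : Type*} [Fintype I] [Nonempty I] (N : ℕ)
    (c : (I → ℕ) → I) :
    ∃ σ : Finset (I → ℕ), σ.Nonempty ∧ (∀ x ∈ σ, ∑ i, x i = N) ∧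
      ∀ x ∈ σ, ∀ i, (∀ z ∈ σ, x i ≤ z i + Fintype.card I) ∧
        (x i ≤ Fintype.card I ∨ ∃ z ∈ σ, c z = i) := by
  classical
  let G : Finset (I → ℕ) := Finset.piAntidiag Finset.univ N
  have hG : ∀ x : I → ℕ, x ∈ G ↔ ∑ i, x i = N := by
    intro x
    simp [G, Finset.mem_piAntidiag]
  have : Nonempty G := ⟨⟨Pi.single (Classical.arbitrary I) N, (hG _).2 (by simp)⟩⟩
  let e := Fintype.equivFin G
  let r : I → G → ℕ := fun i x => e x + Fintype.card G * x.1 i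
  have hr : ∀ i, Function.Injective (r i) := by
    intro i x y hxy
    have := congrArg (· % Fintype.card G) hxy
    simp only [r, Nat.add_mul_mod_self_left, Nat.mod_eq_of_lt (e _).isLt] at this
    exact e.injective (Fin.ext this)
  have hmono : ∀ i x y, r i x ≤ r i y → x.1 i ≤ y.1 i := by
    intro i x y hxy
    by_contra! h
    have h1 : Fintype.card G * (y.1 i + 1) ≤ Fintype.card G * x.1 i := Nat.mul_le_mul_left _ h
    have h2 := (e y).isLt
    simp only [r] at hxy
    rw [mul_add] at h1
    omega
  obtain ⟨τ, hτ, hdom⟩ := exists_dominant_colored hr fun x => c x.1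
  let J : Finset I := τ.image fun x => c x.1
  have hm : ∀ i, ∃ x ∈ τ, ∀ z ∈ τ, x.1 i ≤ z.1 i := fun i =>
    τ.exists_min_image (fun x => x.1 i) hτ
  choose w hw hwmin using hm
  let m : I → ℕ := fun i => (w i).1 i
  have hJne : J.Nonempty := hτ.image _
  have hJ : N < ∑ i ∈ J, (m i + 1) := by
    by_contra! hle
    obtain ⟨j, hj⟩ := hJne
    let y : I → ℕ := fun i => (if i ∈ J then m i + 1 else 0) +
      (if i = j then N - ∑ i ∈ J, (m i + 1) else 0)
    have hy : ∑ i, y i = N := by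
      simp only [y, Finset.sum_add_distrib, Finset.sum_ite_mem, Finset.univ_inter,
        Finset.sum_ite_eq', Finset.mem_univ, if_true] at hle ⊢
      omega
    obtain ⟨z, hz, hzmin⟩ := hdom ⟨y, (hG _).2 hy⟩
    have h1 := hmono _ _ _ (hzmin _ (hw (c z.1)))
    have h2 : c z.1 ∈ J := Finset.mem_image_of_mem _ hz
    simp only [y, if_pos h2, m] at h1
    omega
  have hsum : ∀ x ∈ τ, ∑ i ∈ J, (x.1 i - m i) + ∑ i ∈ Jᶜ, x.1 i < Fintype.card I := by
    intro x hx
    have h1 : ∑ i ∈ J, x.1 i + ∑ i ∈ Jᶜ, x.1 i = N := by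
      rw [Finset.sum_add_sum_compl]
      exact (hG _).1 x.2
    have h2 : ∑ i ∈ J, (x.1 i - m i) + ∑ i ∈ J, m i = ∑ i ∈ J, x.1 i := by
      rw [← Finset.sum_add_distrib]
      exact Finset.sum_congr rfl fun i _ => Nat.sub_add_cancel (hwmin i x hx)
    have h3 : ∑ i ∈ J, (m i + 1) = ∑ i ∈ J, m i + J.card := by
      rw [Finset.sum_add_distrib]
      simp
    have h4 := J.card_le_univ
    omega
  have hin : ∀ x ∈ τ, ∀ i ∈ J, x.1 i ≤ m i + Fintype.card I := by
    intro x hx i hi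
    have h1 := Finset.single_le_sum (f := fun i => x.1 i - m i) (fun _ _ => Nat.zero_le _) hi
    have h2 := hsum x hx
    omega
  have hout : ∀ x ∈ τ, ∀ i ∉ J, x.1 i ≤ Fintype.card I := by
    intro x hx i hi
    have h1 := Finset.single_le_sum (f := fun i => x.1 i) (fun _ _ => Nat.zero_le _)
      (Finset.mem_compl.2 hi)
    have h2 := hsum x hx
    omega
  refine ⟨τ.image Subtype.val, hτ.image _, ?_, ?_⟩
  · intro x hx
    obtain ⟨x, -, rfl⟩ := Finset.mem_image.1 hx
    exact (hG _).1 x.2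
  · intro x hx i
    obtain ⟨x, hxτ, rfl⟩ := Finset.mem_image.1 hx
    by_cases hi : i ∈ J
    · refine ⟨fun z hz => ?_, Or.inr ?_⟩
      · obtain ⟨z, hzτ, rfl⟩ := Finset.mem_image.1 hz
        exact (hin x hxτ i hi).trans (Nat.add_le_add_right (hwmin i z hzτ) _)
      · obtain ⟨z, hz, hzi⟩ := Finset.mem_image.1 hi
        exact ⟨z.1, Finset.mem_image_of_mem _ hz, hzi⟩
    · exact ⟨fun z _ => (hout x hxτ i hi).trans (Nat.le_add_left _ _), Or.inl (hout x hxτ i hi)⟩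

theorem exists_stdSimplex_approx {I : Type*} [Fintype I] [Nonempty I]
    (g : stdSimplex ℝ I → I → ℝ) {N : ℕ} (hN : 0 < N) :
    ∃ x : stdSimplex ℝ I, ∀ i, ∃ y : stdSimplex ℝ I, dist y x ≤ Fintype.card I / N ∧
      (x.1 i ≤ Fintype.card I / N ∨ ∀ j, g y j ≤ g y i) := by
  have hN' : (0 : ℝ) < N := by exact_mod_cast hN
  have hc : ∀ z : I → ℕ, ∃ i, ∀ h : (fun j => (z j : ℝ) / N) ∈ stdSimplex ℝ I,
      ∀ j, g ⟨_, h⟩ j ≤ g ⟨_, h⟩ i := by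
    intro z
    by_cases h : (fun j => (z j : ℝ) / N) ∈ stdSimplex ℝ I
    · obtain ⟨i, hi⟩ := Finite.exists_max (g ⟨_, h⟩)
      exact ⟨i, fun _ => hi⟩
    · exact ⟨Classical.arbitrary I, fun h' => absurd h' h⟩
  choose c hc using hc
  obtain ⟨σ, ⟨x, hx⟩, hsum, hσ⟩ := exists_small_colored_grid N c
  have hmem : ∀ z ∈ σ, (fun j => (z j : ℝ) / N) ∈ stdSimplex ℝ I := by
    intro z hz
    refine ⟨fun j => by positivity, ?_⟩
    rw [← Finset.sum_div, ← Nat.cast_sum, hsum z hz, div_self hN'.ne']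
  refine ⟨⟨_, hmem x hx⟩, fun i => ?_⟩
  rcases (hσ x hx i).2 with h | ⟨z, hz, rfl⟩
  · refine ⟨⟨_, hmem x hx⟩, by rw [dist_self]; positivity, Or.inl ?_⟩
    simp only
    gcongr
  · refine ⟨⟨_, hmem z hz⟩, ?_, Or.inr (hc z (hmem z hz))⟩
    rw [Subtype.dist_eq, dist_pi_le_iff (by positivity)]
    intro j
    have h1 : (z j : ℝ) ≤ x j + Fintype.card I := by exact_mod_cast (hσ z hz j).1 x hx
    have h2 : (x j : ℝ) ≤ z j + Fintype.card I := by exact_mod_cast (hσ x hx j).1 z hz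
    rw [Real.dist_eq, ← sub_div, abs_div, abs_of_pos hN']
    gcongr
    rw [abs_le]
    constructor <;> linarith

/-- A continuous vector field `g` on the standard simplex with `⟪t, g t⟫ ≤ 0` for all `t` takes a
value with no positive coordinate (an equivalent form of Brouwer's fixed point theorem). -/
theorem exists_forall_nonpos_of_sum_mul_nonpos {I : Type*} [Fintype I] [Nonempty I]
    {g : stdSimplex ℝ I → I → ℝ} (hg : Continuous g) (h : ∀ t, ∑ i, t.1 i * g t i ≤ 0) :
    ∃ t, ∀ i, g t i ≤ 0 := by
  choose x y hyx hy using fun N : ℕ => exists_stdSimplex_approx g (Nat.succ_pos N)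
  have : CompactSpace (stdSimplex ℝ I) := isCompact_iff_compactSpace.1 (isCompact_stdSimplex ℝ I)
  obtain ⟨t, φ, hφ, ht⟩ := CompactSpace.tendsto_subseq x
  have heps : Tendsto (fun k => (Fintype.card I : ℝ) / ((φ k).succ : ℕ)) atTop (𝓝 0) :=
    (tendsto_const_div_atTop_nhds_zero_nat _).comp ((tendsto_add_atTop_nat 1).comp hφ.tendsto_atTop)
  have hmax : ∀ i, 0 < t.1 i → ∀ j, g t j ≤ g t i := by
    intro i hi j
    have hyt : Tendsto (fun k => y (φ k) i) atTop (𝓝 t) := by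
      refine (tendsto_iff_of_dist ?_).1 ht
      refine squeeze_zero (fun _ => dist_nonneg) (fun k => ?_) heps
      rw [dist_comm]
      exact hyx (φ k) i
    have hev : ∀ᶠ k in atTop, (Fintype.card I : ℝ) / ((φ k).succ : ℕ) < (x (φ k)).1 i := by
      refine heps.eventually_lt ?_ hi
      exact ((continuous_apply i).comp continuous_subtype_val).continuousAt.tendsto.comp ht
    have hgj : ∀ j, Tendsto (fun k => g (y (φ k) i) j) atTop (𝓝 (g t j)) := fun j =>
      ((continuous_apply j).comp hg).continuousAt.tendsto.comp hyt
    refine le_of_tendsto_of_tendsto (hgj j) (hgj i) ?_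
    filter_upwards [hev] with k hk
    exact (hy (φ k) i).resolve_left hk.not_ge j
  refine ⟨t, fun j => ?_⟩
  calc g t j = ∑ i, t.1 i * g t j := by rw [← Finset.sum_mul, t.2.2, one_mul]
    _ ≤ ∑ i, t.1 i * g t i := by
      refine Finset.sum_le_sum fun i _ => ?_
      rcases (t.2.1 i).eq_or_lt with hi | hi
      · rw [← hi, zero_mul, zero_mul]
      · exact mul_le_mul_of_nonneg_left (hmax i hi j) hi.le
    _ ≤ 0 := h t

/-- **Ky Fan's inequality**. -/
theorem IsCompact.exists_forall_nonpos_of_concaveOn {F : Type*} [AddCommGroup F] [Module ℝ F]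
    [TopologicalSpace F] [ContinuousAdd F] [ContinuousSMul ℝ F] {K : Set F}
    (hK : IsCompact K) (hne : K.Nonempty) (hcv : Convex ℝ K) {φ : K → F → ℝ}
    (hcont : ∀ z ∈ K, Continuous fun y => φ y z) (hconc : ∀ y, ConcaveOn ℝ K (φ y))
    (hdiag : ∀ y : K, φ y y ≤ 0) : ∃ y, ∀ z ∈ K, φ y z ≤ 0 := by
  have := isCompact_iff_compactSpace.1 hK
  have hinter : ((univ : Set K) ∩ ⋂ z : K, {y | φ y z ≤ 0}).Nonempty := by
    refine isCompact_univ.inter_iInter_nonempty _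
      (fun z => isClosed_le (hcont z z.2) continuous_const) fun u => ?_
    rcases u.eq_empty_or_nonempty with rfl | hu
    · obtain ⟨x, hx⟩ := hne
      exact ⟨⟨x, hx⟩, by simp⟩
    have : Nonempty u := hu.to_subtype
    let q : stdSimplex ℝ u → K := fun t => ⟨∑ i, t.1 i • (i.1 : F),
      hcv.sum_mem (fun i _ => t.2.1 i) t.2.2 fun i _ => i.1.2⟩
    have hq : Continuous q := by
      refine Continuous.subtype_mk (continuous_finsetSum _ fun i _ => ?_) _
      exact ((continuous_apply i).comp continuous_subtype_val).smul continuous_const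
    obtain ⟨t, ht⟩ := exists_forall_nonpos_of_sum_mul_nonpos
      (g := fun t i => φ (q t) i.1) (continuous_pi fun i => (hcont i.1 i.1.2).comp hq)
      fun t => ((hconc (q t)).le_map_sum (fun i _ => t.2.1 i) t.2.2 fun i _ => i.1.2).trans
        (hdiag (q t))
    refine ⟨q t, mem_univ _, ?_⟩
    simp only [mem_iInter]
    exact fun z hz => ht ⟨z, hz⟩
  obtain ⟨y, -, hy⟩ := hinter
  exact ⟨y, fun z hz => mem_iInter.1 hy ⟨z, hz⟩⟩

/-- **Kakutani–Fan–Glicksberg fixed point theorem**. -/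
theorem IsCompact.exists_mem_of_upperSemicontinuous {F : Type*} [AddCommGroup F] [Module ℝ F]
    [TopologicalSpace F] [IsTopologicalAddGroup F] [ContinuousSMul ℝ F] [LocallyConvexSpace ℝ F]
    [T2Space F] {K : Set F} (hK : IsCompact K) (hne : K.Nonempty) (hcv : Convex ℝ K)
    {S : F → Set F} (hSK : ∀ x ∈ K, S x ⊆ K) (hSne : ∀ x ∈ K, (S x).Nonempty)
    (hScl : ∀ x ∈ K, IsClosed (S x)) (hScv : ∀ x ∈ K, Convex ℝ (S x))
    (husc : ∀ x ∈ K, ∀ O, IsOpen O → S x ⊆ O → ∀ᶠ y in 𝓝[K] x, S y ⊆ O) :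
    ∃ x ∈ K, x ∈ S x := by
  by_contra! hcon
  have := isCompact_iff_compactSpace.1 hK
  choose f u hfS hfx using fun x : K =>
    geometric_hahn_banach_closed_point (hScv x x.2) (hScl x x.2) (hcon x x.2)
  let U : K → Set K := fun x => interior {y | S y ⊆ {z | f x z < u x} ∧ u x < f x y}
  have hU : ∀ x, x ∈ U x := by
    intro x
    rw [mem_interior_iff_mem_nhds, nhds_subtype_eq_comap_nhdsWithin]
    have h1 := husc x x.2 {z | f x z < u x} (isOpen_lt (f x).continuous continuous_const) (hfS x)
    have h2 : ∀ᶠ y in 𝓝[K] (x : F), u x < f x y :=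
      ((f x).continuous.continuousWithinAt (s := K)).eventually_const_lt (hfx x)
    exact (h1.and h2).comap _
  obtain ⟨ρ, hρ⟩ := PartitionOfUnity.exists_isSubordinate isClosed_univ U
    (fun x => isOpen_interior) fun x _ => mem_iUnion.2 ⟨x, hU x⟩
  have hpos : ∀ y : K, ∀ z ∈ S y, ∀ i ∈ ρ.finsupport y, 0 < ρ i y • (f i y - f i z) := by
    intro y z hz i hi
    have hi : ρ i y ≠ 0 := by simpa using hi
    obtain ⟨h1, h2⟩ := interior_subset (hρ i (subset_tsupport _ hi))
    have h3 : f i z < u i := h1 hz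
    exact mul_pos ((ρ.nonneg i y).lt_of_ne' hi) (by linarith)
  let φ : K → F → ℝ := fun y z => ∑ i ∈ ρ.finsupport y, ρ i y • (f i y - f i z)
  obtain ⟨y, hy⟩ := hK.exists_forall_nonpos_of_concaveOn hne hcv (φ := φ)
    (fun z _ => by
      simp only [φ, ρ.sum_finsupport_smul_eq_finsum (φ := fun i (y : K) => f i y - f i z)]
      exact ρ.continuous_finsum_smul fun i x _ =>
        (((f i).continuous.comp continuous_subtype_val).sub continuous_const).continuousAt)
    (fun y => by
      let L : F →ₗ[ℝ] ℝ := ∑ i ∈ ρ.finsupport y, ρ i y • (f i : F →ₗ[ℝ] ℝ)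
      have hL : φ y = fun z => L y - L z := by
        ext z
        simp [φ, L, mul_sub, Finset.sum_sub_distrib]
      rw [hL]
      exact (concaveOn_const _ hcv).sub (L.convexOn hcv))
    (fun y => by simp [φ])
  obtain ⟨z, hz⟩ := hSne y y.2
  refine (hy z (hSK y y.2 hz)).not_gt (Finset.sum_pos (hpos y z hz) ?_)
  by_contra h
  have h1 := ρ.sum_finsupport (mem_univ y)
  rw [Finset.not_nonempty_iff_eq_empty.1 h] at h1
  simp at h1

/-- Bounded closed convex subsets of a reflexive Banach space are weakly compact. -/
theorem isCompact_toWeakSpace_image {E : Type*} [NormedAddCommGroup E] [NormedSpace ℝ E]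
    (hE : Function.Surjective (NormedSpace.inclusionInDoubleDual ℝ E)) {C : Set E}
    (hbd : Bornology.IsBounded C) (hcl : IsClosed C) (hcv : Convex ℝ C) :
    IsCompact (toWeakSpace ℝ E '' C) := by
  have h := NormedSpace.isCompact_closure_of_isBounded ℝ E (toWeakSpace ℝ E '' C)
    (by rwa [preimage_image_eq _ (toWeakSpace ℝ E).injective])
    (fun x _ => by
      obtain ⟨e, he⟩ := hE (WeakDual.toStrongDual x)
      refine ⟨toWeakSpace ℝ E e, ?_⟩
      rw [NormedSpace.inclusionInDoubleDualWeak_apply, LinearEquiv.symm_apply_apply]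
      exact congrArg StrongDual.toWeakDual he)
  rwa [← hcv.toWeakSpace_closure ℝ, hcl.closure_eq] at h

instance WeakSpace.instLocallyConvexSpace {E : Type*} [NormedAddCommGroup E] [NormedSpace ℝ E] :
    LocallyConvexSpace ℝ (WeakSpace ℝ E) :=
  inferInstanceAs (LocallyConvexSpace ℝ (WeakBilin (topDualPairing ℝ E).flip))

/-- Theorem 2.1 (multivalued Tychonoff fixed point principle): a weakly-weakly
upper semicontinuous multivalued self-map of a nonempty, bounded, closed, convex
subset of a reflexive Banach space with nonempty, bounded, closed, convex values
has a fixed point. -/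
theorem tychonoff_fixed_point
    {E : Type*}
    [NormedAddCommGroup E] [NormedSpace ℝ E] [CompleteSpace E]
    (hErefl : Function.Surjective (NormedSpace.inclusionInDoubleDual ℝ E))
    (C : Set E) (hCne : C.Nonempty) (hCbd : Bornology.IsBounded C)
    (hCcl : IsClosed C) (hCcv : Convex ℝ C)
    (S : E → Set E)
    (hSsub : ∀ x ∈ C, S x ⊆ C)
    (hSne : ∀ x ∈ C, (S x).Nonempty)
    (hSbd : ∀ x ∈ C, Bornology.IsBounded (S x))
    (hScl : ∀ x ∈ C, IsClosed (S x))
    (hScv : ∀ x ∈ C, Convex ℝ (S x))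
    (husc : ∀ x ∈ C, ∀ O : Set (WeakSpace ℝ E), IsOpen O →
      toWeakSpace ℝ E '' S x ⊆ O →
      ∃ N ∈ 𝓝[toWeakSpace ℝ E '' C] (toWeakSpace ℝ E x),
        ∀ y ∈ N, toWeakSpace ℝ E '' S ((toWeakSpace ℝ E).symm y) ⊆ O) :
    ∃ x ∈ C, x ∈ S x := by
  have himg : ∀ {A : Set E}, IsClosed A → Convex ℝ A → IsClosed (toWeakSpace ℝ E '' A) := by
    intro A hcl hcv
    rw [← hcl.closure_eq, hcv.toWeakSpace_closure ℝ]
    exact isClosed_closure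
  obtain ⟨_, ⟨x, hx, rfl⟩, hxS⟩ :=
    (isCompact_toWeakSpace_image hErefl hCbd hCcl hCcv).exists_mem_of_upperSemicontinuous
      (S := fun y => toWeakSpace ℝ E '' S ((toWeakSpace ℝ E).symm y)) (hCne.image _)
      (hCcv.linear_image (toWeakSpace ℝ E).toLinearMap)
      (by
        rintro _ ⟨x, hx, rfl⟩
        rw [LinearEquiv.symm_apply_apply]
        exact image_mono (hSsub x hx))
      (by
        rintro _ ⟨x, hx, rfl⟩
        simpa using hSne x hx)
      (by
        rintro _ ⟨x, hx, rfl⟩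
        simpa using himg (hScl x hx) (hScv x hx))
      (by
        rintro _ ⟨x, hx, rfl⟩
        simpa using (hScv x hx).linear_image (toWeakSpace ℝ E).toLinearMap)
      (by
        rintro _ ⟨x, hx, rfl⟩ O hO hSO
        obtain ⟨N, hN, hNO⟩ := husc x hx O hO (by simpa using hSO)
        exact mem_of_superset hN hNO)
  obtain ⟨y, hy, hyx⟩ := hxS
  rw [(toWeakSpace ℝ E).injective hyx, LinearEquiv.symm_apply_apply] at hy
  exact ⟨x, hx, hy⟩
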